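/- For every connected finite simple graph G with maximum degree at most 6, if n_d denotes the number of vertices of G of degree d, then s(G) ≤ (1/4)·n₃ + (3/8)·n₄ + (19/40)·n₅ + (11/20)·n₆ + 3/20. -/

import Mathlib

open SimpleGraph

/-- `G` has a `K₄` minor (branch-set formulation: four nonempty, pairwise disjoint,
connected branch sets with an edge between every two of them). -/
def HasK4Minor {V : Type*} (G : SimpleGraph V) : Prop :=
  ∃ B : Fin 4 → Set V,
    (∀ i, (B i).Nonempty) ∧
    (∀ i, (G.induce (B i)).Connected) ∧
    (∀ i j, i ≠ j → Disjoint (B i) (B j)) ∧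
    (∀ i j, i ≠ j → ∃ u ∈ B i, ∃ v ∈ B j, G.Adj u v)

/-- `X` is a transversal of `G`: the graph `G − X` has no `K₄` minor. -/
def IsTransversal {V : Type*} (G : SimpleGraph V) (X : Finset V) : Prop :=
  ¬ HasK4Minor (G.induce ((↑X : Set V)ᶜ))

/-- `s(G)`: the minimum size of a transversal of `G`. -/
noncomputable def transNum {V : Type*} (G : SimpleGraph V) : ℕ :=
  sInf {n : ℕ | ∃ X : Finset V, X.card = n ∧ IsTransversal G X}

namespace K4T

/-- `B` is connected, in the cut formulation. -/
def CutConn {V : Type*} (G : SimpleGraph V) (B : Set V) : Prop :=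
  ∀ S : Set V, S ⊆ B → S.Nonempty → (B \ S).Nonempty → ∃ x ∈ S, ∃ y ∈ B \ S, G.Adj x y

/-- `K₄` minor with the cut formulation of connectedness. -/
def K4M {V : Type*} (G : SimpleGraph V) : Prop :=
  ∃ B : Fin 4 → Set V,
    (∀ i, (B i).Nonempty) ∧
    (∀ i, CutConn G (B i)) ∧
    (∀ i j, i ≠ j → Disjoint (B i) (B j)) ∧
    (∀ i j, i ≠ j → ∃ u ∈ B i, ∃ v ∈ B j, G.Adj u v)

/-- Keep only the edges inside `A`. -/
def res {V : Type*} (G : SimpleGraph V) (A : Set V) : SimpleGraph V where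
  Adj x y := G.Adj x y ∧ x ∈ A ∧ y ∈ A
  symm := ⟨fun _ _ h => ⟨h.1.symm, h.2.2, h.2.1⟩⟩
  loopless := ⟨fun x h => G.loopless.irrefl x h.1⟩

theorem res_adj {V : Type*} (G : SimpleGraph V) (A : Set V) (x y : V) :
    (res G A).Adj x y ↔ G.Adj x y ∧ x ∈ A ∧ y ∈ A := Iff.rfl

theorem K4M_mono {V : Type*} {G H : SimpleGraph V} (h : ∀ x y, G.Adj x y → H.Adj x y)
    (hG : K4M G) : K4M H := by
  obtain ⟨B, h1, h2, h3, h4⟩ := hG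
  refine ⟨B, h1, ?_, h3, ?_⟩
  · intro i S a b c
    obtain ⟨x, hx, y, hy, hxy⟩ := h2 i S a b c
    exact ⟨x, hx, y, hy, h _ _ hxy⟩
  · intro i j hij
    obtain ⟨x, hx, y, hy, hxy⟩ := h4 i j hij
    exact ⟨x, hx, y, hy, h _ _ hxy⟩

theorem K4M_of_minor {V : Type*} (G : SimpleGraph V) (A : Set V)
    (h : HasK4Minor (G.induce A)) : K4M (res G A) := by
  obtain ⟨B, h1, h2, h3, h4⟩ := h
  refine ⟨fun i => Subtype.val '' B i, fun i => (h1 i).image _, ?_, ?_, ?_⟩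
  · rintro i S hS ⟨s, hs⟩ ⟨t, ⟨t', ht', rfl⟩, hts⟩
    obtain ⟨s', hs', rfl⟩ := hS hs
    obtain ⟨p⟩ := (h2 i).preconnected ⟨s', hs'⟩ ⟨t', ht'⟩
    obtain ⟨d, -, hd1, hd2⟩ := p.exists_boundary_dart {z | z.1.1 ∈ S} hs hts
    refine ⟨d.fst.1.1, hd1, d.snd.1.1, ⟨⟨d.snd.1, d.snd.2, rfl⟩, hd2⟩, ?_, d.fst.1.2, d.snd.1.2⟩
    exact d.adj
  · intro i j hij
    exact (Set.disjoint_image_iff Subtype.val_injective).2 (h3 i j hij)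
  · intro i j hij
    obtain ⟨x, hx, y, hy, hxy⟩ := h4 i j hij
    exact ⟨x.1, ⟨x, hx, rfl⟩, y.1, ⟨y, hy, rfl⟩, hxy, x.2, y.2⟩

/-- Suppressing a vertex with at most two neighbours. -/
theorem K4M_suppress {V : Type*} {G G' : SimpleGraph V} (v a b : V)
    (h1 : ∀ x y, x ≠ v → y ≠ v → G.Adj x y → G'.Adj x y)
    (h2 : ∀ x y, G.Adj v x → G.Adj v y → x ≠ y → G'.Adj x y)
    (h3 : ∀ x, G.Adj v x → x = a ∨ x = b) (hG : K4M G) : K4M G' := by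
  classical
  obtain ⟨B, b1, b2, b3, b4⟩ := hG
  have hd : ∀ i j x, x ∈ B i → x ∈ B j → i = j := by
    intro i j x hi hj
    by_contra hij
    exact Set.disjoint_left.1 (b3 i j hij) hi hj
  have hne : ∀ i, (B i \ {v}).Nonempty := by
    intro i
    by_contra hcon
    have hsub : ∀ x ∈ B i, x = v := by
      intro x hx
      by_contra hxv
      exact hcon ⟨x, hx, hxv⟩
    have hn : ∀ j, j ≠ i → ∃ y ∈ B j, G.Adj v y := by
      intro j hj
      obtain ⟨x, hx, y, hy, hxy⟩ := b4 i j hj.symm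
      rw [hsub x hx] at hxy
      exact ⟨y, hy, hxy⟩
    have h3 : ∀ j, j ≠ i → a ∈ B j ∨ b ∈ B j := by
      intro j hj
      obtain ⟨y, hy, hv⟩ := hn j hj
      rcases h3 y hv with rfl | rfl
      · exact Or.inl hy
      · exact Or.inr hy
    have key : ∀ i : Fin 4, ∃ j k l : Fin 4,
        j ≠ i ∧ k ≠ i ∧ l ≠ i ∧ j ≠ k ∧ j ≠ l ∧ k ≠ l := by decide
    obtain ⟨j, k, l, hj, hk, hl, hjk, hjl, hkl⟩ := key i
    rcases h3 j hj with p | p <;> rcases h3 k hk with q | q <;> rcases h3 l hl with r | r <;>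
      first
      | exact hjk (hd _ _ _ p q)
      | exact hjl (hd _ _ _ p r)
      | exact hkl (hd _ _ _ q r)
  have hadj : ∀ i j, i ≠ j → ∃ u ∈ B i \ {v}, ∃ w ∈ B j, w ≠ v → G'.Adj u w := by
    intro i j hij
    obtain ⟨x, hx, y, hy, hxy⟩ := b4 i j hij
    by_cases hxv : x = v
    · subst hxv
      obtain ⟨z, hz, w, hw, hzw⟩ := b2 i {x} (by simpa using hx) ⟨x, rfl⟩ (hne i)
      rw [Set.mem_singleton_iff] at hz
      subst hz
      refine ⟨w, hw, y, hy, fun _ => h2 _ _ hzw hxy ?_⟩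
      rintro rfl
      exact hij (hd _ _ _ hw.1 hy)
    · exact ⟨x, ⟨hx, hxv⟩, y, hy, fun hyv => h1 _ _ hxv hyv hxy⟩
  refine ⟨fun i => B i \ {v}, hne, ?_, ?_, ?_⟩
  · intro i S hS hSn hTn
    have hSv : v ∉ S := fun h => (hS h).2 rfl
    obtain ⟨t, ht, htS⟩ := hTn
    obtain ⟨s, hs⟩ := hSn
    obtain ⟨x, hx, y, hy, hxy⟩ := b2 i S (fun z hz => (hS hz).1) ⟨s, hs⟩ ⟨t, ht.1, htS⟩
    have hxv : x ≠ v := fun h => hSv (h ▸ hx)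
    by_cases hyv : y = v
    · subst hyv
      obtain ⟨x', hx', y', hy', hxy'⟩ := b2 i (S ∪ {y})
        (by
          rintro z (hz | hz)
          · exact (hS hz).1
          · rw [Set.mem_singleton_iff] at hz
            rw [hz]; exact hy.1)
        ⟨s, Or.inl hs⟩ ⟨t, ht.1, by
          rintro (h | h)
          · exact htS h
          · exact ht.2 h⟩
      have hy'S : y' ∉ S := fun h => hy'.2 (Or.inl h)
      have hy'v : y' ≠ y := fun h => hy'.2 (Or.inr h)
      refine ⟨if x' = y then x else x', ?_, y', ⟨⟨hy'.1, hy'v⟩, hy'S⟩, ?_⟩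
      · split_ifs with hh
        · exact hx
        · rcases hx' with h | h
          · exact h
          · exact absurd h hh
      · split_ifs with hh
        · subst hh
          refine h2 _ _ hxy.symm hxy' ?_
          rintro rfl
          exact hy'S hx
        · exact h1 _ _ hh hy'v hxy'
    · exact ⟨x, hx, y, ⟨⟨hy.1, hyv⟩, hy.2⟩, h1 _ _ hxv hyv hxy⟩
  · intro i j hij
    exact (b3 i j hij).mono Set.sdiff_subset Set.sdiff_subset
  · intro i j hij
    by_cases hvj : v ∈ B j
    · obtain ⟨u, hu, w, hw, huw⟩ := hadj j i hij.symm
      have hwv : w ≠ v := by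
        rintro rfl
        exact hij (hd _ _ _ hw hvj)
      exact ⟨w, ⟨hw, hwv⟩, u, hu, (huw hwv).symm⟩
    · obtain ⟨u, hu, w, hw, huw⟩ := hadj i j hij
      have hwv : w ≠ v := by
        rintro rfl
        exact hvj hw
      exact ⟨u, hu, w, ⟨hw, hwv⟩, huw hwv⟩

theorem K4M_side {V : Type*} {G : SimpleGraph V} (P Q : Set V) (c : V)
    (hcP : c ∈ P) (hPQ : ∀ x, x ∈ P → x ∈ Q → x = c)
    (hE : ∀ x y, G.Adj x y → (x ∈ P ∧ y ∈ P) ∨ (x ∈ Q ∧ y ∈ Q))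
    (B : Fin 4 → Set V) (b1 : ∀ i, (B i).Nonempty) (b2 : ∀ i, CutConn G (B i))
    (b3 : ∀ i j, i ≠ j → Disjoint (B i) (B j))
    (b4 : ∀ i j, i ≠ j → ∃ u ∈ B i, ∃ v ∈ B j, G.Adj u v)
    (hB : ∀ i, c ∉ B i → B i ⊆ P) : K4M (res G P) := by
  have hP : ∀ x y, G.Adj x y → x ∈ P → x ≠ c → y ∈ P := by
    intro x y h hx hxc
    rcases hE x y h with h | h
    · exact h.2
    · exact absurd (hPQ x hx h.1) hxc
  refine ⟨fun i => B i ∩ P, ?_, ?_, ?_, ?_⟩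
  · intro i
    by_cases hc : c ∈ B i
    · exact ⟨c, hc, hcP⟩
    · obtain ⟨x, hx⟩ := b1 i
      exact ⟨x, hx, hB i hc hx⟩
  · intro i S hS hSn hTn
    obtain ⟨s, hs⟩ := hSn
    obtain ⟨t, ht, htS⟩ := hTn
    by_cases hc : c ∈ S
    · obtain ⟨x, hx, y, hy, hxy⟩ := b2 i ((B i ∩ P) \ S) (fun z hz => hz.1.1) ⟨t, ht, htS⟩
        ⟨s, (hS hs).1, fun h => h.2 hs⟩
      have hyP : y ∈ P := hP x y hxy hx.1.2 (fun h => hx.2 (h ▸ hc))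
      have hyS : y ∈ S := by
        by_contra h
        exact hy.2 ⟨⟨hy.1, hyP⟩, h⟩
      exact ⟨y, hyS, x, hx, hxy.symm, hyP, hx.1.2⟩
    · obtain ⟨x, hx, y, hy, hxy⟩ := b2 i S (fun z hz => (hS hz).1) ⟨s, hs⟩ ⟨t, ht.1, htS⟩
      have hyP : y ∈ P := hP x y hxy (hS hx).2 (fun h => hc (h ▸ hx))
      exact ⟨x, hx, y, ⟨⟨hy.1, hyP⟩, hy.2⟩, hxy, (hS hx).2, hyP⟩
  · intro i j hij
    exact (b3 i j hij).mono Set.inter_subset_left Set.inter_subset_left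
  · intro i j hij
    obtain ⟨x, hx, y, hy, hxy⟩ := b4 i j hij
    by_cases hc : c ∈ B i
    · have hcj : c ∉ B j := fun h => Set.disjoint_left.1 (b3 i j hij) hc h
      have hyP := hB j hcj hy
      have hxP := hP y x hxy.symm hyP (fun h => hcj (h ▸ hy))
      exact ⟨x, ⟨hx, hxP⟩, y, ⟨hy, hyP⟩, hxy, hxP, hyP⟩
    · have hxP := hB i hc hx
      have hyP := hP x y hxy hxP (fun h => hc (h ▸ hx))
      exact ⟨x, ⟨hx, hxP⟩, y, ⟨hy, hyP⟩, hxy, hxP, hyP⟩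

theorem K4M_split {V : Type*} {G : SimpleGraph V} (P Q : Set V) (c : V)
    (hcP : c ∈ P) (hcQ : c ∈ Q) (hPQ : ∀ x, x ∈ P → x ∈ Q → x = c)
    (hU : ∀ x, x ∈ P ∨ x ∈ Q)
    (hE : ∀ x y, G.Adj x y → (x ∈ P ∧ y ∈ P) ∨ (x ∈ Q ∧ y ∈ Q))
    (hG : K4M G) : K4M (res G P) ∨ K4M (res G Q) := by
  obtain ⟨B, b1, b2, b3, b4⟩ := hG
  have hside : ∀ i, c ∉ B i → B i ⊆ P ∨ B i ⊆ Q := by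
    intro i hc
    by_contra hcon
    rw [not_or, Set.not_subset, Set.not_subset] at hcon
    obtain ⟨⟨x, hx, hxP⟩, y, hy, hyQ⟩ := hcon
    have hyP : y ∈ P := (hU y).resolve_right hyQ
    obtain ⟨s, hs, t, ht, hst⟩ := b2 i (B i ∩ P) Set.inter_subset_left ⟨y, hy, hyP⟩
      ⟨x, hx, fun h => hxP h.2⟩
    rcases hE s t hst with h | h
    · exact ht.2 ⟨ht.1, h.2⟩
    · exact hc (hPQ s hs.2 h.1 ▸ hs.1)
  by_cases hall : ∀ i, c ∉ B i → B i ⊆ P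
  · exact Or.inl (K4M_side P Q c hcP hPQ hE B b1 b2 b3 b4 hall)
  · push Not at hall
    obtain ⟨i, hci, hi⟩ := hall
    have hiQ := (hside i hci).resolve_left hi
    refine Or.inr (K4M_side Q P c hcQ (fun x a b => hPQ x b a) (fun x y h => (hE x y h).symm)
      B b1 b2 b3 b4 ?_)
    intro j hcj
    rcases hside j hcj with hj | hj
    · exfalso
      have hij : i ≠ j := by
        rintro rfl
        exact hi hj
      obtain ⟨x, hx, y, hy, hxy⟩ := b4 i j hij
      rcases hE x y hxy with h | h
      · exact hci (hPQ x h.1 (hiQ hx) ▸ hx)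
      · exact hcj (hPQ y (hj hy) h.2 ▸ hy)
    · exact hj

open Classical in
/-- The finset of neighbours. -/
noncomputable def nb {V : Type*} [Fintype V] (G : SimpleGraph V) (x : V) : Finset V :=
  Finset.univ.filter (fun y => G.Adj x y)

/-- The degree. -/
noncomputable def dg {V : Type*} [Fintype V] (G : SimpleGraph V) (x : V) : ℕ := (nb G x).card

/-- Delete a vertex (keeping it as an isolated vertex). -/
def del {V : Type*} (G : SimpleGraph V) (v : V) : SimpleGraph V := res G {v}ᶜ

/-- Degree sum. -/
noncomputable def msr {V : Type*} [Fintype V] (G : SimpleGraph V) : ℕ := ∑ x, dg G x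

/-- The weight function (multiplied by 40). -/
def fw : ℕ → ℤ
  | 0 => 0
  | 1 => 0
  | 2 => 0
  | 3 => 10
  | 4 => 15
  | 5 => 19
  | _ => 22

/-- Decrements of the weight function. -/
def dl (d : ℕ) : ℤ := fw d - fw (d - 1)

/-- Total weight. -/
noncomputable def W {V : Type*} [Fintype V] (G : SimpleGraph V) : ℤ := ∑ x, fw (dg G x)

/-- There is a transversal of size at most `(W G + t) / 40`. -/
def Good {V : Type*} [Fintype V] (G : SimpleGraph V) (t : ℤ) : Prop :=
  ∃ X : Finset V, 40 * (X.card : ℤ) ≤ W G + t ∧ ¬ K4M (res G (↑X : Set V)ᶜ)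

/-- Connected up to isolated vertices. -/
def Conn {V : Type*} [Fintype V] (G : SimpleGraph V) : Prop :=
  ∀ S : Set V, (∀ x y, G.Adj x y → x ∈ S → y ∈ S) → (∃ x ∈ S, 0 < dg G x) →
    ∀ x, 0 < dg G x → x ∈ S

section
variable {V : Type*} [Fintype V]

theorem mem_nb {G : SimpleGraph V} {x y : V} : y ∈ nb G x ↔ G.Adj x y := by
  simp [nb]

theorem dg_pos {G : SimpleGraph V} {x : V} : 0 < dg G x ↔ ∃ y, G.Adj x y := by
  unfold dg
  rw [Finset.card_pos]
  constructor
  · rintro ⟨y, hy⟩; exact ⟨y, mem_nb.1 hy⟩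
  · rintro ⟨y, hy⟩; exact ⟨y, mem_nb.2 hy⟩

theorem dg_le {G H : SimpleGraph V} {x : V} (h : ∀ y, G.Adj x y → H.Adj x y) :
    dg G x ≤ dg H x :=
  Finset.card_le_card (fun y hy => mem_nb.2 (h y (mem_nb.1 hy)))

theorem dg_congr {G H : SimpleGraph V} {x : V} (h : ∀ y, G.Adj x y ↔ H.Adj x y) :
    dg G x = dg H x :=
  le_antisymm (dg_le fun y => (h y).1) (dg_le fun y => (h y).2)

theorem dg_zero {G : SimpleGraph V} {x : V} (h : ∀ y, ¬ G.Adj x y) : dg G x = 0 := by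
  by_contra h0
  obtain ⟨y, hy⟩ := dg_pos.1 (Nat.pos_of_ne_zero h0)
  exact h y hy

theorem dg_res_le (G : SimpleGraph V) (A : Set V) (x : V) : dg (res G A) x ≤ dg G x :=
  dg_le fun _ h => h.1

theorem dg_del_self (G : SimpleGraph V) (v : V) : dg (del G v) v = 0 :=
  dg_zero fun _ h => h.2.1 rfl

theorem dg_del_adj {G : SimpleGraph V} {v x : V} (h : G.Adj v x) :
    dg (del G v) x + 1 = dg G x := by
  classical
  have : nb (del G v) x = (nb G x).erase v := by
    ext y
    rw [Finset.mem_erase, mem_nb, mem_nb]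
    constructor
    · intro hh; exact ⟨hh.2.2, hh.1⟩
    · intro hh; exact ⟨hh.2, h.ne', hh.1⟩
  unfold dg
  rw [this]
  exact Finset.card_erase_add_one (mem_nb.2 h.symm)

theorem dg_del_nadj {G : SimpleGraph V} {v x : V} (hx : x ≠ v) (h : ¬ G.Adj v x) :
    dg (del G v) x = dg G x := by
  refine dg_congr fun y => ⟨fun hh => hh.1, fun hh => ⟨hh, hx, ?_⟩⟩
  rintro rfl
  exact h hh.symm

theorem dg_del_le (G : SimpleGraph V) (v x : V) : dg (del G v) x ≤ dg G x := dg_res_le _ _ _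

theorem dg_del_ge {G : SimpleGraph V} {v x : V} (hx : x ≠ v) :
    dg G x ≤ dg (del G v) x + 1 := by
  by_cases h : G.Adj v x
  · exact (dg_del_adj h).ge
  · rw [dg_del_nadj hx h]; omega

theorem msr_lt {G H : SimpleGraph V} (h : ∀ x, dg H x ≤ dg G x) (z : V)
    (hz : dg H z < dg G z) : msr H < msr G :=
  Finset.sum_lt_sum (fun x _ => h x) ⟨z, Finset.mem_univ _, hz⟩

theorem msr_del {G : SimpleGraph V} {v : V} (h : 0 < dg G v) : msr (del G v) < msr G :=
  msr_lt (dg_del_le G v) v (by rw [dg_del_self]; exact h)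

theorem fw_mono : Monotone fw := by
  refine monotone_nat_of_le_succ fun n => ?_
  match n with
  | 0 | 1 | 2 | 3 | 4 | 5 => decide
  | n + 6 => exact le_refl _

theorem fw_nonneg (n : ℕ) : 0 ≤ fw n := fw_mono (Nat.zero_le n)

theorem W_le {G H : SimpleGraph V} (h : ∀ x, dg H x ≤ dg G x) : W H ≤ W G :=
  Finset.sum_le_sum fun x _ => fw_mono (h x)

theorem W_nonneg (G : SimpleGraph V) : 0 ≤ W G := Finset.sum_nonneg fun _ _ => fw_nonneg _

theorem W_del (G : SimpleGraph V) (v : V) :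
    W G = W (del G v) + fw (dg G v) + ∑ x ∈ nb G v, dl (dg G x) := by
  classical
  have h1 : ∑ x ∈ nb G v, dl (dg G x) = ∑ x, if x ∈ nb G v then dl (dg G x) else 0 := by
    rw [Finset.sum_ite_mem, Finset.univ_inter]
  have h2 : fw (dg G v) = ∑ x, if x = v then fw (dg G x) else 0 := by
    rw [Finset.sum_ite_eq' Finset.univ v]; simp
  rw [h1, h2]
  unfold W
  rw [← Finset.sum_add_distrib, ← Finset.sum_add_distrib]
  refine Finset.sum_congr rfl fun x _ => ?_
  by_cases hx : x = v
  · subst hx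
    have : x ∉ nb G x := fun h => G.loopless.irrefl _ (mem_nb.1 h)
    simp [this, dg_del_self, fw]
  · by_cases ha : G.Adj v x
    · have h3 := dg_del_adj ha
      have h4 : dg (del G v) x = dg G x - 1 := by omega
      simp [hx, mem_nb, ha, h4, dl]
    · simp [hx, mem_nb, ha, dg_del_nadj hx ha]

theorem sum_nb1 {G : SimpleGraph V} {v : V} {c : ℤ} (h : ∀ x, G.Adj v x → c ≤ dl (dg G x)) :
    (dg G v : ℤ) * c ≤ ∑ x ∈ nb G v, dl (dg G x) := by
  have := Finset.card_nsmul_le_sum (nb G v) (fun x => dl (dg G x)) c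
    (fun x hx => h x (mem_nb.1 hx))
  simpa [dg] using this

theorem sum_nb2 {G : SimpleGraph V} {v u : V} {c : ℤ} (hu : G.Adj v u)
    (h : ∀ x, G.Adj v x → c ≤ dl (dg G x)) :
    dl (dg G u) + ((dg G v : ℤ) - 1) * c ≤ ∑ x ∈ nb G v, dl (dg G x) := by
  classical
  rw [← Finset.add_sum_erase _ _ (mem_nb.2 hu)]
  have := Finset.card_nsmul_le_sum ((nb G v).erase u) (fun x => dl (dg G x)) c
    (fun x hx => h x (mem_nb.1 (Finset.mem_of_mem_erase hx)))
  have hc := Finset.card_erase_add_one (mem_nb.2 hu)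
  have hc' : (((nb G v).erase u).card : ℤ) = (dg G v : ℤ) - 1 := by
    unfold dg; omega
  rw [nsmul_eq_mul, hc'] at this
  linarith

theorem sum_nb3 {G : SimpleGraph V} {v u w : V} {c : ℤ} (hu : G.Adj v u) (hw : G.Adj v w)
    (huw : u ≠ w) (h : ∀ x, G.Adj v x → c ≤ dl (dg G x)) :
    dl (dg G u) + dl (dg G w) + ((dg G v : ℤ) - 2) * c ≤ ∑ x ∈ nb G v, dl (dg G x) := by
  classical
  have hw' : w ∈ (nb G v).erase u := Finset.mem_erase.2 ⟨huw.symm, mem_nb.2 hw⟩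
  rw [← Finset.add_sum_erase _ _ (mem_nb.2 hu), ← Finset.add_sum_erase _ _ hw']
  have := Finset.card_nsmul_le_sum (((nb G v).erase u).erase w) (fun x => dl (dg G x)) c
    (fun x hx => h x (mem_nb.1 (Finset.mem_of_mem_erase (Finset.mem_of_mem_erase hx))))
  have hc := Finset.card_erase_add_one (mem_nb.2 hu)
  have hc2 := Finset.card_erase_add_one hw'
  have hc' : ((((nb G v).erase u).erase w).card : ℤ) = (dg G v : ℤ) - 2 := by
    unfold dg; omega
  rw [nsmul_eq_mul, hc'] at this
  linarith

theorem Good_le {G : SimpleGraph V} {t t' : ℤ} (h : t ≤ t') (hG : Good G t) : Good G t' := by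
  obtain ⟨X, h1, h2⟩ := hG
  exact ⟨X, by linarith, h2⟩

theorem Good_del {G : SimpleGraph V} (v : V) {t t' : ℤ} (hG : Good (del G v) t)
    (h : W (del G v) + t + 40 ≤ W G + t') : Good G t' := by
  classical
  obtain ⟨X, h1, h2⟩ := hG
  refine ⟨insert v X, ?_, fun hk => h2 (K4M_mono ?_ hk)⟩
  · have : ((insert v X).card : ℤ) ≤ X.card + 1 := by exact_mod_cast Finset.card_insert_le v X
    linarith
  · rintro x y ⟨h, hx, hy⟩
    simp only [Finset.coe_insert, Set.mem_compl_iff, Set.mem_insert_iff, not_or] at hx hy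
    exact ⟨⟨h, hx.1, hy.1⟩, hx.2, hy.2⟩

theorem Good_transfer {G H : SimpleGraph V} {t t' : ℤ} (hH : Good H t)
    (hK : ∀ A : Set V, K4M (res G A) → K4M (res H A))
    (h : W H + t ≤ W G + t') : Good G t' := by
  obtain ⟨X, h1, h2⟩ := hH
  exact ⟨X, by linarith, fun hk => h2 (hK _ hk)⟩

theorem Good_empty {G : SimpleGraph V} (h : ∀ x, dg G x = 0) : Good G 0 := by
  refine ⟨∅, ?_, ?_⟩
  · have := W_nonneg G
    simpa using this
  · rintro ⟨B, -, -, -, h4⟩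
    obtain ⟨x, -, y, -, hxy⟩ := h4 0 1 (by decide)
    have := dg_pos.2 ⟨y, hxy.1⟩
    rw [h x] at this
    exact lt_irrefl _ this

theorem Conn_suppress {G H : SimpleGraph V} (v : V) (hG : Conn G)
    (h1 : ∀ x y, x ≠ v → y ≠ v → G.Adj x y → H.Adj x y)
    (h2 : ∀ x y, G.Adj v x → G.Adj v y → x ≠ y → H.Adj x y)
    (hle : ∀ x, dg H x ≤ dg G x) (hv : dg H v = 0) : Conn H := by
  intro S hS hex z hz
  obtain ⟨x0, hx0, hp⟩ := hex
  have hne : ∀ x, 0 < dg H x → x ≠ v := by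
    rintro x hx rfl
    omega
  have key := hG {x | (x ≠ v ∧ x ∈ S) ∨ (x = v ∧ ∃ y ∈ S, G.Adj v y)} ?_
    ⟨x0, Or.inl ⟨hne _ hp, hx0⟩, lt_of_lt_of_le hp (hle _)⟩ z (lt_of_lt_of_le hz (hle _))
  · rcases key with h | h
    · exact h.2
    · exact absurd h.1 (hne _ hz)
  · rintro x y hxy (⟨hxv, hxS⟩ | ⟨rfl, w, hw, hvw⟩)
    · by_cases hy : y = v
      · subst hy
        exact Or.inr ⟨rfl, x, hxS, hxy.symm⟩
      · exact Or.inl ⟨hy, hS x y (h1 x y hxv hy hxy) hxS⟩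
    · refine Or.inl ⟨hxy.ne', ?_⟩
      by_cases hwy : w = y
      · exact hwy ▸ hw
      · exact hS w y (h2 w y hvw hxy hwy) hw

theorem K4M_suppress_res {G H : SimpleGraph V} (v a b : V)
    (h1 : ∀ x y, x ≠ v → y ≠ v → G.Adj x y → H.Adj x y)
    (h2 : ∀ x y, G.Adj v x → G.Adj v y → x ≠ y → H.Adj x y)
    (h3 : ∀ x, G.Adj v x → x = a ∨ x = b) (A : Set V) (hK : K4M (res G A)) :
    K4M (res H A) :=
  K4M_suppress (G := res G A) v a b (fun x y hx hy h => ⟨h1 x y hx hy h.1, h.2⟩)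
    (fun x y hx hy h => ⟨h2 x y hx.1 hy.1 h, hx.2.2, hy.2.2⟩) (fun x h => h3 x h.1) hK

/-- Removing a vertex of degree one. -/
theorem reduce_one {G : SimpleGraph V} {v : V} (hG : Conn G) (hv : dg G v = 1) :
    Conn (del G v) ∧ ∀ A : Set V, K4M (res G A) → K4M (res (del G v) A) := by
  obtain ⟨a, ha⟩ := Finset.card_eq_one.1 hv
  have h3 : ∀ x, G.Adj v x → x = a := by
    intro x hx
    have := mem_nb.2 hx
    rw [ha] at this
    exact Finset.mem_singleton.1 this
  have h1 : ∀ x y, x ≠ v → y ≠ v → G.Adj x y → (del G v).Adj x y :=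
    fun x y hx hy h => ⟨h, hx, hy⟩
  have h2 : ∀ x y, G.Adj v x → G.Adj v y → x ≠ y → (del G v).Adj x y :=
    fun x y hx hy h => absurd ((h3 x hx).trans (h3 y hy).symm) h
  exact ⟨Conn_suppress v hG h1 h2 (dg_del_le G v) (dg_del_self G v),
    K4M_suppress_res v a a h1 h2 (fun x hx => Or.inl (h3 x hx))⟩

/-- Suppressing a vertex of degree two. -/
theorem reduce_two {G : SimpleGraph V} {v : V} (hG : Conn G) (hv : dg G v = 2) :
    ∃ H : SimpleGraph V, Conn H ∧ (∀ A : Set V, K4M (res G A) → K4M (res H A)) ∧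
      (∀ x, dg H x ≤ dg G x) ∧ dg H v = 0 ∧
      ((∀ x, x ≠ v → dg H x = dg G x) ∨
        ∃ a b, a ≠ b ∧ G.Adj v a ∧ G.Adj v b ∧ dg H a + 1 = dg G a ∧ dg H b + 1 = dg G b) := by
  classical
  obtain ⟨a, b, hab, hn⟩ := Finset.card_eq_two.1 hv
  have h3 : ∀ x, G.Adj v x ↔ x = a ∨ x = b := by
    intro x
    rw [← mem_nb, hn]
    simp
  have hva : G.Adj v a := (h3 a).2 (Or.inl rfl)
  have hvb : G.Adj v b := (h3 b).2 (Or.inr rfl)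
  by_cases hadj : G.Adj a b
  · have h1 : ∀ x y, x ≠ v → y ≠ v → G.Adj x y → (del G v).Adj x y :=
      fun x y hx hy h => ⟨h, hx, hy⟩
    have h2 : ∀ x y, G.Adj v x → G.Adj v y → x ≠ y → (del G v).Adj x y := by
      intro x y hx hy h
      refine ⟨?_, hx.ne', hy.ne'⟩
      rcases (h3 x).1 hx with rfl | rfl <;> rcases (h3 y).1 hy with rfl | rfl
      · exact absurd rfl h
      · exact hadj
      · exact hadj.symm
      · exact absurd rfl h
    exact ⟨del G v, Conn_suppress v hG h1 h2 (dg_del_le G v) (dg_del_self G v),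
      K4M_suppress_res v a b h1 h2 (fun x hx => (h3 x).1 hx), dg_del_le G v, dg_del_self G v,
      Or.inr ⟨a, b, hab, hva, hvb, dg_del_adj hva, dg_del_adj hvb⟩⟩
  · let H : SimpleGraph V :=
      { Adj := fun x y => (del G v).Adj x y ∨ (x = a ∧ y = b) ∨ (x = b ∧ y = a)
        symm := ⟨by
          rintro x y (h | h | h)
          · exact Or.inl h.symm
          · exact Or.inr (Or.inr ⟨h.2, h.1⟩)
          · exact Or.inr (Or.inl ⟨h.2, h.1⟩)⟩
        loopless := ⟨by
          rintro x (h | h | h)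
          · exact (del G v).loopless.irrefl _ h
          · exact hab (h.1.symm.trans h.2)
          · exact hab (h.2.symm.trans h.1)⟩ }
    have hH : ∀ x y, H.Adj x y ↔ ((del G v).Adj x y ∨ (x = a ∧ y = b) ∨ (x = b ∧ y = a)) :=
      fun x y => Iff.rfl
    have h1 : ∀ x y, x ≠ v → y ≠ v → G.Adj x y → H.Adj x y :=
      fun x y hx hy h => Or.inl ⟨h, hx, hy⟩
    have h2 : ∀ x y, G.Adj v x → G.Adj v y → x ≠ y → H.Adj x y := by
      intro x y hx hy h
      rcases (h3 x).1 hx with rfl | rfl <;> rcases (h3 y).1 hy with rfl | rfl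
      · exact absurd rfl h
      · exact Or.inr (Or.inl ⟨rfl, rfl⟩)
      · exact Or.inr (Or.inr ⟨rfl, rfl⟩)
      · exact absurd rfl h
    have hv0 : dg H v = 0 := by
      refine dg_zero fun y hy => ?_
      rcases (hH _ _).1 hy with h | h | h
      · exact h.2.1 rfl
      · exact hva.ne h.1
      · exact hvb.ne h.1
    have hda : nb H a = insert b (nb (del G v) a) := by
      ext y
      rw [Finset.mem_insert, mem_nb, mem_nb, hH]
      constructor
      · rintro (h | h | h)
        · exact Or.inr h
        · exact Or.inl h.2
        · exact absurd h.1 hab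
      · rintro (h | h)
        · exact Or.inr (Or.inl ⟨rfl, h⟩)
        · exact Or.inl h
    have hdb : nb H b = insert a (nb (del G v) b) := by
      ext y
      rw [Finset.mem_insert, mem_nb, mem_nb, hH]
      constructor
      · rintro (h | h | h)
        · exact Or.inr h
        · exact absurd h.1.symm hab
        · exact Or.inl h.2
      · rintro (h | h)
        · exact Or.inr (Or.inr ⟨rfl, h⟩)
        · exact Or.inl h
    have ea : dg H a = dg G a := by
      rw [← dg_del_adj hva]
      unfold dg
      rw [hda]
      exact Finset.card_insert_of_notMem fun h => hadj (mem_nb.1 h).1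
    have eb : dg H b = dg G b := by
      rw [← dg_del_adj hvb]
      unfold dg
      rw [hdb]
      exact Finset.card_insert_of_notMem fun h => hadj (mem_nb.1 h).1.symm
    have he : ∀ x, x ≠ v → dg H x = dg G x := by
      intro x hx
      by_cases hxa : x = a
      · rw [hxa]; exact ea
      by_cases hxb : x = b
      · rw [hxb]; exact eb
      rw [← dg_del_nadj hx (fun h => ((h3 x).1 h).elim hxa hxb)]
      refine dg_congr fun y => ?_
      rw [hH]
      simp [hxa, hxb]
    have hle : ∀ x, dg H x ≤ dg G x := by
      intro x
      by_cases hx : x = v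
      · rw [hx, hv0]; exact Nat.zero_le _
      · exact (he x hx).le
    exact ⟨H, Conn_suppress v hG h1 h2 hle hv0,
      K4M_suppress_res v a b h1 h2 (fun x hx => (h3 x).1 hx), hle, hv0, Or.inl he⟩

end

section
variable {V : Type*} [Fintype V]

/-- `v` separates `A` from the rest. -/
def CutAt (G : SimpleGraph V) (v : V) (A : Set V) : Prop :=
  v ∉ A ∧ (∀ x y, G.Adj x y → x ∈ A → y ∈ A ∨ y = v) ∧ (∃ x ∈ A, 0 < dg G x) ∧
    (∃ x, x ∉ A ∧ x ≠ v ∧ 0 < dg G x)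

theorem CutAt_symm {G : SimpleGraph V} {v : V} {A : Set V} (h : CutAt G v A) :
    CutAt G v (insert v A)ᶜ := by
  obtain ⟨h1, h2, ⟨x, hx, hxp⟩, y, hyA, hyv, hyp⟩ := h
  refine ⟨fun h => h (Or.inl rfl), ?_, ⟨y, ?_, hyp⟩, x, ?_, ?_, hxp⟩
  · intro x y hxy hx
    by_cases hyv : y = v
    · exact Or.inr hyv
    · refine Or.inl ?_
      rintro (h | h)
      · exact hyv h
      · rcases h2 y x hxy.symm h with h | h
        · exact hx (Or.inr h)
        · exact hx (Or.inl h)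
  · rintro (h | h)
    · exact hyv h
    · exact hyA h
  · exact fun h => h (Or.inr hx)
  · rintro rfl
    exact h1 hx

theorem exists_cut {G : SimpleGraph V} {v : V} (h : ¬ Conn (del G v)) : ∃ A, CutAt G v A := by
  unfold Conn at h
  push Not at h
  obtain ⟨S, hS, ⟨x, hx, hxp⟩, y, hyp, hy⟩ := h
  have hne : ∀ x, 0 < dg (del G v) x → x ≠ v := by
    rintro x hx rfl
    rw [dg_del_self] at hx
    exact lt_irrefl _ hx
  refine ⟨S \ {v}, fun h => h.2 rfl, ?_, ⟨x, ⟨hx, hne x hxp⟩, lt_of_lt_of_le hxp (dg_del_le _ _ _)⟩,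
    y, fun h => hy h.1, hne y hyp, lt_of_lt_of_le hyp (dg_del_le _ _ _)⟩
  intro a b hab ha
  by_cases hb : b = v
  · exact Or.inr hb
  · exact Or.inl ⟨hS a b ⟨hab, ha.2, hb⟩ ha.1, hb⟩

theorem side_in {G : SimpleGraph V} {v : V} {A : Set V} (h : CutAt G v A) {x : V} (hx : x ∈ A) :
    dg (res G (insert v A)) x = dg G x :=
  dg_congr fun y => ⟨fun h => h.1, fun hh => ⟨hh, Or.inr hx, (h.2.1 x y hh hx).symm⟩⟩

theorem side_out {G : SimpleGraph V} {v : V} {A : Set V} {x : V} (hx : x ∉ A)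
    (hxv : x ≠ v) : dg (res G (insert v A)) x = 0 :=
  dg_zero fun _ h => h.2.1.elim hxv hx

theorem side_pos {G : SimpleGraph V} {v : V} {A : Set V} (hG : Conn G) (h : CutAt G v A) :
    0 < dg (res G (insert v A)) v := by
  obtain ⟨h1, h2, h3, y, hyA, hyv, hyp⟩ := h
  by_contra h0
  refine hyA (hG A ?_ h3 y hyp)
  intro a b hab ha
  rcases h2 a b hab ha with h | h
  · exact h
  · exfalso
    subst h
    exact h0 (dg_pos.2 ⟨a, hab.symm, Or.inl rfl, Or.inr ha⟩)

theorem side_conn {G : SimpleGraph V} {v : V} {A : Set V} (hG : Conn G) (h : CutAt G v A) :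
    Conn (res G (insert v A)) := by
  intro S hS hex z hz
  obtain ⟨x0, hx0, hp⟩ := hex
  have hmem : ∀ x, 0 < dg (res G (insert v A)) x → x ∈ insert v A := by
    intro x hx
    obtain ⟨y, hy⟩ := dg_pos.1 hx
    exact hy.2.1
  by_cases hv : v ∈ S
  · have key := hG {x | x ∈ S ∨ x ∉ insert v A} ?_ ⟨x0, Or.inl hx0, lt_of_lt_of_le hp (dg_res_le _ _ _)⟩
      z (lt_of_lt_of_le hz (dg_res_le _ _ _))
    · exact key.resolve_right fun h => h (hmem z hz)
    · intro x y hxy hx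
      by_cases hy : y ∈ insert v A
      · left
        by_cases hxP : x ∈ insert v A
        · have hxS : x ∈ S := hx.resolve_right fun h => h hxP
          exact hS x y ⟨hxy, hxP, hy⟩ hxS
        · rcases hy with rfl | hy
          · exact hv
          · exact absurd (h.2.1 y x hxy.symm hy).symm hxP
      · exact Or.inr hy
  · have key := hG (S ∩ insert v A) ?_ ⟨x0, ⟨hx0, hmem _ hp⟩, lt_of_lt_of_le hp (dg_res_le _ _ _)⟩
      z (lt_of_lt_of_le hz (dg_res_le _ _ _))
    · exact key.1
    · rintro x y hxy ⟨hxS, hxP⟩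
      have hxA : x ∈ A := hxP.resolve_left fun h => hv (h ▸ hxS)
      have hy : y ∈ insert v A := (h.2.1 x y hxy hxA).symm
      exact ⟨hS x y ⟨hxy, hxP, hy⟩ hxS, hy⟩

/-- `G` is split at `v` into `G1` and `G2`. -/
structure Split (G : SimpleGraph V) (v : V) (G1 G2 : SimpleGraph V) : Prop where
  c1 : Conn G1
  c2 : Conn G2
  p1 : 0 < dg G1 v
  p2 : 0 < dg G2 v
  sum : dg G1 v + dg G2 v = dg G v
  oth : ∀ x, x ≠ v → (dg G1 x = dg G x ∧ dg G2 x = 0) ∨ (dg G1 x = 0 ∧ dg G2 x = dg G x)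
  good : ∀ t1 t2 t, Good G1 t1 → Good G2 t2 →
    t1 + t2 + fw (dg G1 v) + fw (dg G2 v) ≤ t + fw (dg G v) → Good G t

theorem Split.symm {G : SimpleGraph V} {v : V} {G1 G2 : SimpleGraph V} (h : Split G v G1 G2) :
    Split G v G2 G1 where
  c1 := h.c2
  c2 := h.c1
  p1 := h.p2
  p2 := h.p1
  sum := by rw [add_comm]; exact h.sum
  oth := fun x hx => (h.oth x hx).symm.imp (fun a => ⟨a.2, a.1⟩) (fun a => ⟨a.2, a.1⟩)
  good := fun t1 t2 t a b c => h.good t2 t1 t b a (by linarith)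

theorem split_W {G G1 G2 : SimpleGraph V} {v : V}
    (oth : ∀ x, x ≠ v → (dg G1 x = dg G x ∧ dg G2 x = 0) ∨ (dg G1 x = 0 ∧ dg G2 x = dg G x)) :
    W G + fw (dg G1 v) + fw (dg G2 v) = W G1 + W G2 + fw (dg G v) := by
  classical
  have h2 : ∀ H : SimpleGraph V, fw (dg H v) = ∑ x, if x = v then fw (dg H x) else 0 := by
    intro H
    rw [Finset.sum_ite_eq' Finset.univ v]; simp
  rw [h2 G, h2 G1, h2 G2]
  unfold W
  rw [← Finset.sum_add_distrib, ← Finset.sum_add_distrib, ← Finset.sum_add_distrib,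
    ← Finset.sum_add_distrib]
  refine Finset.sum_congr rfl fun x _ => ?_
  by_cases hx : x = v
  · simp [hx]; ring
  · rcases oth x hx with h | h <;> simp [hx, h.1, h.2, fw]

theorem cut_split {G : SimpleGraph V} {v : V} {A : Set V} (hG : Conn G) (h : CutAt G v A) :
    Split G v (res G (insert v A)) (res G (insert v (insert v A)ᶜ)) := by
  classical
  have h' := CutAt_symm h
  have hoth : ∀ x, x ≠ v →
      (dg (res G (insert v A)) x = dg G x ∧ dg (res G (insert v (insert v A)ᶜ)) x = 0) ∨
      (dg (res G (insert v A)) x = 0 ∧ dg (res G (insert v (insert v A)ᶜ)) x = dg G x) := by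
    intro x hx
    by_cases hA : x ∈ A
    · exact Or.inl ⟨side_in h hA, side_out (fun h => h (Or.inr hA)) hx⟩
    · exact Or.inr ⟨side_out hA hx, side_in h' (by
        rintro (h | h)
        · exact hx h
        · exact hA h)⟩
  refine ⟨side_conn hG h, side_conn hG h', side_pos hG h, side_pos hG h', ?_, hoth, ?_⟩
  · unfold dg
    rw [← Finset.card_union_of_disjoint]
    · congr 1
      ext y
      rw [Finset.mem_union, mem_nb, mem_nb, mem_nb]
      constructor
      · rintro (h | h)
        · exact h.1
        · exact h.1
      · intro hy
        by_cases hyA : y ∈ A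
        · exact Or.inl ⟨hy, Or.inl rfl, Or.inr hyA⟩
        · refine Or.inr ⟨hy, Or.inl rfl, Or.inr ?_⟩
          rintro (h | h)
          · exact hy.ne' h
          · exact hyA h
    · rw [Finset.disjoint_left]
      intro y h1 h2
      rw [mem_nb] at h1 h2
      rcases h2.2.2 with h | h
      · exact h1.1.ne' h
      · exact h h1.2.2
  · rintro t1 t2 t ⟨X1, a1, b1⟩ ⟨X2, a2, b2⟩ hle
    refine ⟨X1 ∪ X2, ?_, ?_⟩
    · have hc : ((X1 ∪ X2).card : ℤ) ≤ X1.card + X2.card := by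
        exact_mod_cast Finset.card_union_le X1 X2
      have hW := split_W hoth
      linarith
    · intro hK
      have hPQ : ∀ x, x ∈ insert v A → x ∈ insert v (insert v A)ᶜ → x = v := by
        rintro x hx (hx' | hx')
        · exact hx'
        · exact absurd hx hx'
      have hU : ∀ x, x ∈ insert v A ∨ x ∈ insert v (insert v A)ᶜ := by
        intro x
        by_cases hx : x ∈ insert v A
        · exact Or.inl hx
        · exact Or.inr (Or.inr hx)
      have hE : ∀ x y, (res G ((↑(X1 ∪ X2) : Set V))ᶜ).Adj x y → (x ∈ insert v A ∧ y ∈ insert v A) ∨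
          (x ∈ insert v (insert v A)ᶜ ∧ y ∈ insert v (insert v A)ᶜ) := by
        intro x y hxy
        have hxy := hxy.1
        by_cases hx : x ∈ A
        · exact Or.inl ⟨Or.inr hx, (h.2.1 x y hxy hx).symm⟩
        · by_cases hy : y ∈ A
          · exact Or.inl ⟨(h.2.1 y x hxy.symm hy).symm, Or.inr hy⟩
          · right
            have hh : ∀ z, z ∉ A → z ∈ insert v (insert v A)ᶜ := by
              intro z hz
              by_cases hzv : z = v
              · exact Or.inl hzv
              · refine Or.inr ?_
                rintro (h | h)
                · exact hzv h
                · exact hz h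
            exact ⟨hh x hx, hh y hy⟩
      rcases K4M_split (insert v A) (insert v (insert v A)ᶜ) v (Or.inl rfl) (Or.inl rfl)
        hPQ hU hE hK with hK | hK
      · refine b1 (K4M_mono ?_ hK)
        rintro x y ⟨⟨hxy, hx, hy⟩, hx', hy'⟩
        simp only [Finset.coe_union, Set.mem_compl_iff, Set.mem_union, not_or] at hx hy
        exact ⟨⟨hxy, hx', hy'⟩, hx.1, hy.1⟩
      · refine b2 (K4M_mono ?_ hK)
        rintro x y ⟨⟨hxy, hx, hy⟩, hx', hy'⟩
        simp only [Finset.coe_union, Set.mem_compl_iff, Set.mem_union, not_or] at hx hy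
        exact ⟨⟨hxy, hx', hy'⟩, hx.2, hy.2⟩

theorem Split.le1 {G : SimpleGraph V} {v : V} {G1 G2 : SimpleGraph V} (h : Split G v G1 G2)
    (x : V) : dg G1 x ≤ dg G x := by
  by_cases hx : x = v
  · rw [hx]; have := h.sum; omega
  · rcases h.oth x hx with h | h <;> omega

theorem Split.msr1 {G : SimpleGraph V} {v : V} {G1 G2 : SimpleGraph V} (h : Split G v G1 G2) :
    msr G1 < msr G :=
  msr_lt h.le1 v (by have := h.sum; have := h.p2; omega)

/-- `vu` is a bridge of `G`, with sides `H1 ∋ u` and `H2 ∋ v`. -/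
structure Bridge (G : SimpleGraph V) (v u : V) (H1 H2 : SimpleGraph V) : Prop where
  c1 : Conn H1
  c2 : Conn H2
  m1 : msr H1 < msr G
  m2 : msr H2 < msr G
  d1 : dg H1 u + 1 = dg G u
  d2 : dg H2 v + 1 = dg G v
  o1 : ∀ x, x ≠ u → dg H1 x = 0 ∨ dg H1 x = dg G x
  o2 : ∀ x, x ≠ v → dg H2 x = 0 ∨ dg H2 x = dg G x
  good : ∀ t1 t2 t, Good H1 t1 → Good H2 t2 →
    t1 + t2 ≤ t + dl (dg G u) + dl (dg G v) → Good G t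

theorem Split.bridge {G : SimpleGraph V} {v : V} {G1 G2 : SimpleGraph V} (h : Split G v G1 G2)
    (h1 : dg G1 v = 1) : ∃ u, Bridge G v u (del G1 v) G2 := by
  obtain ⟨u, hu⟩ := dg_pos.1 h.p1
  obtain ⟨hc, hK⟩ := reduce_one h.c1 h1
  have hsum := h.sum
  have hud := dg_del_adj hu
  have huv : u ≠ v := hu.ne'
  have hGu : dg G1 u = dg G u := by
    rcases h.oth u huv with h | h
    · exact h.1
    · omega
  have honly : ∀ x, G1.Adj v x → x = u := by
    obtain ⟨a, ha⟩ := Finset.card_eq_one.1 h1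
    intro x hx
    have e1 := mem_nb.2 hx
    have e2 := mem_nb.2 hu
    rw [ha, Finset.mem_singleton] at e1 e2
    exact e1.trans e2.symm
  refine ⟨u, hc, h.c2, lt_trans (msr_del h.p1) h.msr1, h.symm.msr1, by omega, by omega, ?_, ?_, ?_⟩
  · intro x hx
    by_cases hxv : x = v
    · rw [hxv]; exact Or.inl (dg_del_self _ _)
    · rw [dg_del_nadj hxv fun h => hx (honly x h)]
      rcases h.oth x hxv with h | h
      · exact Or.inr h.1
      · exact Or.inl h.1
  · intro x hx
    rcases h.oth x hx with h | h
    · exact Or.inl h.2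
    · exact Or.inr h.2
  · intro t1 t2 t g1 g2 hle
    have hW := W_del G1 v
    have hs : ∑ x ∈ nb G1 v, dl (dg G1 x) = dl (dg G u) := by
      have : nb G1 v = {u} := by
        ext x
        rw [mem_nb, Finset.mem_singleton]
        exact ⟨honly x, fun h => h ▸ hu⟩
      rw [this, Finset.sum_singleton, hGu]
    rw [h1, hs] at hW
    have g1' : Good G1 (t1 - dl (dg G u)) := by
      refine Good_transfer g1 hK ?_
      have : fw 1 = 0 := rfl
      linarith
    refine h.good _ _ _ g1' g2 ?_
    have e : dg G2 v = dg G v - 1 := by omega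
    rw [h1, e]
    have : fw 1 = 0 := rfl
    unfold dl at *
    linarith

/-- A cut vertex gives a bridge or a split with both degrees at least two. -/
theorem cut_cases {G : SimpleGraph V} {v : V} {A : Set V} (hG : Conn G) (h : CutAt G v A) :
    (∃ v u H1 H2, Bridge G v u H1 H2) ∨
    (∃ G1 G2, Split G v G1 G2 ∧ 2 ≤ dg G1 v ∧ dg G1 v ≤ dg G2 v) := by
  have hs := cut_split hG h
  have p1 := hs.p1
  have p2 := hs.p2
  by_cases h1 : dg (res G (insert v A)) v = 1
  · obtain ⟨u, hb⟩ := hs.bridge h1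
    exact Or.inl ⟨_, _, _, _, hb⟩
  by_cases h2 : dg (res G (insert v (insert v A)ᶜ)) v = 1
  · obtain ⟨u, hb⟩ := hs.symm.bridge h2
    exact Or.inl ⟨_, _, _, _, hb⟩
  right
  rcases le_total (dg (res G (insert v A)) v) (dg (res G (insert v (insert v A)ᶜ)) v) with hle | hle
  · exact ⟨_, _, hs, by omega, hle⟩
  · exact ⟨_, _, hs.symm, by omega, hle⟩

end

section
variable {V : Type*} [Fintype V]

def Mx (G : SimpleGraph V) (k : ℕ) : Prop := ∀ x, dg G x ≤ k
def Md (G : SimpleGraph V) : Prop := ∀ x, dg G x = 0 ∨ 3 ≤ dg G x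
def Reg (G : SimpleGraph V) (k : ℕ) : Prop := ∀ x, dg G x = 0 ∨ dg G x = k

/-- The statement proved by induction. -/
structure Main (G : SimpleGraph V) : Prop where
  a : Mx G 6 → Good G 6
  b : Mx G 5 → Md G → ¬ Reg G 5 → ¬ Reg G 4 → Good G 2
  c : Mx G 4 → Good G 5
  d : Mx G 4 → Md G → ¬ Reg G 4 → Good G 0
  e : Mx G 3 → Good G 0

def IH (G : SimpleGraph V) : Prop := ∀ H : SimpleGraph V, msr H < msr G → Conn H → Main H

theorem dl_ge3 {d : ℕ} (h1 : 3 ≤ d) (h2 : d ≤ 6) : 3 ≤ dl d := by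
  interval_cases d <;> decide
theorem dl_ge4 {d : ℕ} (h1 : 3 ≤ d) (h2 : d ≤ 5) : 4 ≤ dl d := by
  interval_cases d <;> decide
theorem dl_ge5 {d : ℕ} (h1 : 3 ≤ d) (h2 : d ≤ 4) : 5 ≤ dl d := by
  interval_cases d <;> decide
theorem dl_ge10 {d : ℕ} (h1 : 3 ≤ d) (h2 : d ≤ 3) : 10 ≤ dl d := by
  interval_cases d; decide

theorem Md.adj {G : SimpleGraph V} (h : Md G) {v x : V} (hx : G.Adj v x) : 3 ≤ dg G x := by
  have := dg_pos.2 ⟨v, hx.symm⟩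
  rcases h x with h | h <;> omega

theorem Md.pos {G : SimpleGraph V} (h : Md G) {x : V} (hx : 0 < dg G x) : 3 ≤ dg G x := by
  rcases h x with h | h <;> omega

theorem exists_elig {G : SimpleGraph V} (hG : Conn G) {z : V} {k : ℕ} (hk : 0 < k)
    (hz : dg G z = k) (hr : ¬ Reg G k) : ∃ v u, G.Adj v u ∧ dg G v = k ∧ dg G u ≠ k := by
  by_contra hcon
  push Not at hcon
  refine hr fun x => ?_
  rcases Nat.eq_zero_or_pos (dg G x) with h | h
  · exact Or.inl h
  · exact Or.inr (hG {x | dg G x = k} (fun a b hab ha => hcon a b hab ha) ⟨z, hz, by omega⟩ x h)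

theorem Md_del {G : SimpleGraph V} (h : Md G) {v : V} (hv : ∀ x, G.Adj v x → dg G x ≠ 3) :
    Md (del G v) := by
  intro x
  by_cases hx : x = v
  · rw [hx]; exact Or.inl (dg_del_self _ _)
  by_cases ha : G.Adj v x
  · have h1 := dg_del_adj ha
    have h2 := h.adj ha
    have h3 := hv x ha
    right; omega
  · rw [dg_del_nadj hx ha]; exact h x

theorem Mx_del {G : SimpleGraph V} {k : ℕ} (h : Mx G k) (v : V) : Mx (del G v) k :=
  fun x => (dg_del_le G v x).trans (h x)

theorem not_Reg {G : SimpleGraph V} {k : ℕ} (x : V) (h0 : dg G x ≠ 0) (hk : dg G x ≠ k) :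
    ¬ Reg G k := fun h => (h x).elim h0 hk

theorem W_two {G H : SimpleGraph V} (h : ∀ x, dg H x ≤ dg G x) {a b : V} (hab : a ≠ b) :
    W H + (fw (dg G a) - fw (dg H a)) + (fw (dg G b) - fw (dg H b)) ≤ W G := by
  classical
  have h1 : ∑ x ∈ ({a, b} : Finset V), (fw (dg G x) - fw (dg H x)) ≤
      ∑ x, (fw (dg G x) - fw (dg H x)) :=
    Finset.sum_le_sum_of_subset_of_nonneg (Finset.subset_univ _)
      (fun x _ _ => sub_nonneg.2 (fw_mono (h x)))
  rw [Finset.sum_pair hab, Finset.sum_sub_distrib] at h1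
  unfold W
  linarith

theorem step_low {G : SimpleGraph V} (hG : Conn G) (ih : IH G) {v : V}
    (hv : dg G v = 1 ∨ dg G v = 2) : Main G := by
  have hex : ∃ H : SimpleGraph V, Conn H ∧ (∀ A : Set V, K4M (res G A) → K4M (res H A)) ∧
      (∀ x, dg H x ≤ dg G x) ∧ dg H v = 0 := by
    rcases hv with hv | hv
    · obtain ⟨h1, h2⟩ := reduce_one hG hv
      exact ⟨del G v, h1, h2, dg_del_le G v, dg_del_self G v⟩
    · obtain ⟨H, h1, h2, h3, h4, -⟩ := reduce_two hG hv
      exact ⟨H, h1, h2, h3, h4⟩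
  obtain ⟨H, hc, hK, hle, h0⟩ := hex
  have hm := ih H (msr_lt hle v (by omega)) hc
  have hmx : ∀ k, Mx G k → Mx H k := fun k h x => (hle x).trans (h x)
  have tr : ∀ t, Good H t → Good G t := fun t ht => Good_transfer ht hK (by linarith [W_le hle])
  have hmd : ¬ Md G := fun h => by
    rcases h v with h | h <;> omega
  exact ⟨fun h => tr _ (hm.a (hmx _ h)), fun _ h => absurd h hmd, fun h => tr _ (hm.c (hmx _ h)),
    fun _ h => absurd h hmd, fun h => tr _ (hm.e (hmx _ h))⟩

theorem Bridge.mx1 {G : SimpleGraph V} {v u : V} {H1 H2 : SimpleGraph V}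
    (h : Bridge G v u H1 H2) {k : ℕ} (hk : Mx G k) : Mx H1 k := by
  intro x
  have := hk x
  by_cases hx : x = u
  · have := h.d1; subst hx; omega
  · rcases h.o1 x hx with h | h <;> omega

theorem Bridge.mx2 {G : SimpleGraph V} {v u : V} {H1 H2 : SimpleGraph V}
    (h : Bridge G v u H1 H2) {k : ℕ} (hk : Mx G k) : Mx H2 k := by
  intro x
  have := hk x
  by_cases hx : x = v
  · have := h.d2; subst hx; omega
  · rcases h.o2 x hx with h | h <;> omega

theorem Split.mx1 {G : SimpleGraph V} {v : V} {H1 H2 : SimpleGraph V}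
    (h : Split G v H1 H2) {k : ℕ} (hk : Mx G k) : Mx H1 k := fun x => (h.le1 x).trans (hk x)

theorem Bridge.u3 {G : SimpleGraph V} {v u : V} {H1 H2 : SimpleGraph V}
    (h : Bridge G v u H1 H2) (hmd : Md G) : 3 ≤ dg G u := by
  have := h.d1
  exact hmd.pos (by omega)

theorem Bridge.v3 {G : SimpleGraph V} {v u : V} {H1 H2 : SimpleGraph V}
    (h : Bridge G v u H1 H2) (hmd : Md G) : 3 ≤ dg G v := by
  have := h.d2
  exact hmd.pos (by omega)

theorem step_e {G : SimpleGraph V} (hG : Conn G) (ih : IH G) (hmd : Md G) (hmx : Mx G 3) :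
    Good G 0 := by
  by_cases h0 : ∀ x, dg G x = 0
  · exact Good_empty h0
  push Not at h0
  obtain ⟨v, hv⟩ := h0
  have hv3 : dg G v = 3 := by
    have := hmx v
    rcases hmd v with h | h <;> omega
  by_cases hc : Conn (del G v)
  · have hm := ih _ (msr_del (by omega)) hc
    refine Good_del v (hm.e (Mx_del hmx v)) ?_
    have hW := W_del G v
    have hs := sum_nb1 (G := G) (v := v) (c := 10) (fun x hx => dl_ge10 (hmd.adj hx) (hmx x))
    rw [hv3] at hW hs
    have : fw 3 = 10 := rfl
    push_cast at hs
    linarith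
  · obtain ⟨A, hA⟩ := exists_cut hc
    rcases cut_cases hG hA with ⟨w, u, H1, H2, hb⟩ | ⟨G1, G2, hs, h1, h2⟩
    · refine hb.good 0 0 0 ((ih _ hb.m1 hb.c1).e (hb.mx1 hmx)) ((ih _ hb.m2 hb.c2).e (hb.mx2 hmx)) ?_
      linarith [dl_ge3 (hb.u3 hmd) ((hmx u).trans (by norm_num)),
        dl_ge3 (hb.v3 hmd) ((hmx w).trans (by norm_num))]
    · have := hs.sum
      omega

theorem cut4 {G : SimpleGraph V} (hG : Conn G) (ih : IH G) (hmd : Md G) (hmx : Mx G 4)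
    {v : V} {A : Set V} (hA : CutAt G v A) : Good G 0 := by
  rcases cut_cases hG hA with ⟨w, u, H1, H2, hb⟩ | ⟨G1, G2, hs, h1, h2⟩
  · refine hb.good 5 5 0 ((ih _ hb.m1 hb.c1).c (hb.mx1 hmx)) ((ih _ hb.m2 hb.c2).c (hb.mx2 hmx)) ?_
    linarith [dl_ge5 (hb.u3 hmd) (hmx u), dl_ge5 (hb.v3 hmd) (hmx w)]
  · have hsum := hs.sum
    have hv := hmx v
    refine hs.good 5 5 0 ((ih _ hs.msr1 hs.c1).c (hs.mx1 hmx))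
      ((ih _ hs.symm.msr1 hs.c2).c (hs.symm.mx1 hmx)) ?_
    have e1 : dg G1 v = 2 := by omega
    have e2 : dg G2 v = 2 := by omega
    have e : dg G v = 4 := by omega
    rw [e, e1, e2]
    decide

theorem step_d {G : SimpleGraph V} (hG : Conn G) (ih : IH G) (hmd : Md G) (hmx : Mx G 4)
    (hr : ¬ Reg G 4) : Good G 0 := by
  by_cases h3 : Mx G 3
  · exact step_e hG ih hmd h3
  obtain ⟨z, hz⟩ : ∃ z, dg G z = 4 := by
    unfold Mx at h3
    push Not at h3
    obtain ⟨z, hz⟩ := h3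
    exact ⟨z, by have := hmx z; omega⟩
  obtain ⟨v, u, hvu, hv, hu⟩ := exists_elig hG (by norm_num) hz hr
  have hu3 : dg G u = 3 := by
    have := hmx u
    have := hmd.adj hvu
    omega
  by_cases hc : Conn (del G v)
  swap
  · obtain ⟨A, hA⟩ := exists_cut hc
    exact cut4 hG ih hmd hmx hA
  have hlt := msr_del (G := G) (v := v) (by omega)
  have hW := W_del G v
  have d3 : dl 3 = 10 := rfl
  have f4 : fw 4 = 15 := rfl
  by_cases h2 : ∃ w, G.Adj v w ∧ u ≠ w ∧ dg G w = 3
  · obtain ⟨w, hvw, huw, hw⟩ := h2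
    refine Good_del v ((ih _ hlt hc).c (Mx_del hmx v)) ?_
    have hs := sum_nb3 (c := 5) hvu hvw huw (fun x hx => dl_ge5 (hmd.adj hx) (hmx x))
    rw [hv, hu3, hw, d3] at hs
    rw [hv, f4] at hW
    push_cast at hs
    linarith
  · push Not at h2
    have hs := sum_nb2 (c := 5) hvu (fun x hx => dl_ge5 (hmd.adj hx) (hmx x))
    rw [hv, hu3, d3] at hs
    rw [hv, f4] at hW
    push_cast at hs
    have hdu := dg_del_adj hvu
    have hmH : ∀ x, x ≠ u → dg (del G v) x = 0 ∨ 3 ≤ dg (del G v) x := by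
      intro x hxu
      by_cases hx : x = v
      · rw [hx]; exact Or.inl (dg_del_self _ _)
      by_cases ha : G.Adj v x
      · have e1 := dg_del_adj ha
        have e2 := hmd.adj ha
        have e3 := h2 x ha hxu.symm
        right; omega
      · rw [dg_del_nadj hx ha]; exact hmd x
    suffices hgood : Good (del G v) 0 from Good_del v hgood (by linarith)
    obtain ⟨H, hHc, hHK, hHle, hHu, hH⟩ := reduce_two hc (v := u) (by omega)
    have hHlt : msr H < msr G := lt_trans (msr_lt hHle u (by omega)) hlt
    have hHmx : Mx H 4 := fun x => (hHle x).trans (Mx_del hmx v x)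
    rcases hH with hH | ⟨a, b, hab, hua, hub, ha, hb⟩
    · have hHmd : Md H := by
        intro x
        by_cases hx : x = u
        · rw [hx]; exact Or.inl hHu
        · rw [hH x hx]; exact hmH x hx
      obtain ⟨w, hw, hwu⟩ := Finset.exists_mem_ne (s := nb G v) (by
        have : (nb G v).card = 4 := hv
        omega) u
      rw [mem_nb] at hw
      have e1 := dg_del_adj hw
      have e2 := hmd.adj hw
      have e3 := h2 w hw hwu.symm
      have e4 := hmx w
      have e5 := hH w hwu
      exact Good_transfer ((ih _ hHlt hHc).d hHmx hHmd (not_Reg w (by omega) (by omega))) hHK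
        (by linarith [W_le hHle])
    · refine Good_transfer ((ih _ hHlt hHc).c hHmx) hHK ?_
      have hWt := W_two hHle hab
      have key : ∀ x, (del G v).Adj u x → dg H x + 1 = dg (del G v) x →
          5 ≤ fw (dg (del G v) x) - fw (dg H x) := by
        intro x hux hx
        have e1 := Mx_del hmx v x
        have e2 : 3 ≤ dg (del G v) x := by
          rcases hmH x hux.ne' with h | h
          · have := dg_pos.2 ⟨u, hux.symm⟩
            omega
          · exact h
        have e3 := dl_ge5 e2 e1
        unfold dl at e3
        rw [← hx, Nat.add_sub_cancel] at e3
        rw [← hx]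
        exact e3
      linarith [key a hua ha, key b hub hb]

theorem step_c {G : SimpleGraph V} (hG : Conn G) (ih : IH G) (hmd : Md G) (hmx : Mx G 4) :
    Good G 5 := by
  by_cases hr : Reg G 4
  swap
  · exact Good_le (by norm_num) (step_d hG ih hmd hmx hr)
  by_cases h0 : ∀ x, dg G x = 0
  · exact Good_le (by norm_num) (Good_empty h0)
  push Not at h0
  obtain ⟨v, hv⟩ := h0
  have hv4 : dg G v = 4 := (hr v).resolve_left hv
  by_cases hc : Conn (del G v)
  swap
  · obtain ⟨A, hA⟩ := exists_cut hc
    exact Good_le (by norm_num) (cut4 hG ih hmd hmx hA)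
  have h4 : ∀ x, G.Adj v x → dg G x = 4 := by
    intro x hx
    have := hmd.adj hx
    rcases hr x with h | h <;> omega
  obtain ⟨w, hw⟩ := dg_pos.1 (show 0 < dg G v by omega)
  have e1 := dg_del_adj hw
  have e2 := h4 w hw
  refine Good_del v ((ih _ (msr_del (by omega)) hc).d (Mx_del hmx v)
    (Md_del hmd fun x hx => by rw [h4 x hx]; decide) (not_Reg w (by omega) (by omega))) ?_
  have hW := W_del G v
  have hs := sum_nb1 (G := G) (v := v) (c := 5) (fun x hx => dl_ge5 (hmd.adj hx) (hmx x))
  rw [hv4] at hW hs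
  have : fw 4 = 15 := rfl
  push_cast at hs
  linarith

/-- One side of a bridge. -/
theorem bridge_side {G H : SimpleGraph V} (ih : IH G) (hmd : Md G) (hmx : Mx G 5) {u : V}
    (hlt : msr H < msr G) (hc : Conn H) (hu : dg H u + 1 = dg G u)
    (ho : ∀ x, x ≠ u → dg H x = 0 ∨ dg H x = dg G x) : Good H (dl (dg G u) + 1) := by
  have hm := ih H hlt hc
  have hu5 := hmx u
  have hu3 : 3 ≤ dg G u := hmd.pos (by omega)
  have hHmx : Mx H 5 := by
    intro x
    have := hmx x
    by_cases hx : x = u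
    · subst hx; omega
    · rcases ho x hx with h | h <;> omega
  have hHmd : dg G u ≠ 3 → Md H := by
    intro h3 x
    by_cases hx : x = u
    · subst hx; omega
    · rcases ho x hx with h | h
      · exact Or.inl h
      · rw [h]; exact hmd x
  rcases (by omega : dg G u = 3 ∨ dg G u = 4 ∨ dg G u = 5) with h | h | h
  · rw [h]
    exact Good_le (by decide) (hm.a fun x => (hHmx x).trans (by norm_num))
  · rw [h]
    exact Good_le (by decide) (hm.b hHmx (hHmd (by omega)) (not_Reg u (by omega) (by omega))
      (not_Reg u (by omega) (by omega)))
  · rw [h]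
    by_cases hr : Reg H 4
    · exact Good_le (by decide) (hm.c fun x => by rcases hr x with h | h <;> omega)
    · exact Good_le (by decide) (hm.b hHmx (hHmd (by omega)) (not_Reg u (by omega) (by omega)) hr)

theorem cut5 {G : SimpleGraph V} (hG : Conn G) (ih : IH G) (hmd : Md G) (hmx : Mx G 5)
    {v : V} {A : Set V} (hA : CutAt G v A) : Good G 2 := by
  have hmx6 : Mx G 6 := fun x => (hmx x).trans (by norm_num)
  rcases cut_cases hG hA with ⟨w, u, H1, H2, hb⟩ | ⟨G1, G2, hs, h1, h2⟩
  · exact hb.good _ _ 2 (bridge_side ih hmd hmx hb.m1 hb.c1 hb.d1 hb.o1)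
      (bridge_side ih hmd hmx hb.m2 hb.c2 hb.d2 hb.o2) (by linarith)
  · have hsum := hs.sum
    have hv := hmx v
    have e1 : dg G1 v = 2 := by omega
    have g1 := (ih _ hs.msr1 hs.c1).a (hs.mx1 hmx6)
    rcases (by omega : dg G2 v = 2 ∨ dg G2 v = 3) with e2 | e2
    · have e : dg G v = 4 := by omega
      refine hs.good 6 6 2 g1 ((ih _ hs.symm.msr1 hs.c2).a (hs.symm.mx1 hmx6)) ?_
      rw [e, e1, e2]
      decide
    · have e : dg G v = 5 := by omega
      have hmd2 : Md G2 := by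
        intro x
        by_cases hx : x = v
        · subst hx; omega
        · rcases hs.oth x hx with h | h
          · exact Or.inl h.2
          · rw [h.2]; exact hmd x
      refine hs.good 6 2 2 g1 ((ih _ hs.symm.msr1 hs.c2).b (hs.symm.mx1 hmx) hmd2
        (not_Reg v (by omega) (by omega)) (not_Reg v (by omega) (by omega))) ?_
      rw [e, e1, e2]
      decide

theorem step_b {G : SimpleGraph V} (hG : Conn G) (ih : IH G) (hmd : Md G) (hmx : Mx G 5)
    (hr5 : ¬ Reg G 5) (hr4 : ¬ Reg G 4) : Good G 2 := by
  by_cases h4 : Mx G 4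
  · exact Good_le (by norm_num) (step_d hG ih hmd h4 hr4)
  obtain ⟨z, hz⟩ : ∃ z, dg G z = 5 := by
    unfold Mx at h4
    push Not at h4
    obtain ⟨z, hz⟩ := h4
    exact ⟨z, by have := hmx z; omega⟩
  obtain ⟨v, u, hvu, hv, hu⟩ := exists_elig hG (by norm_num) hz hr5
  by_cases hc : Conn (del G v)
  swap
  · obtain ⟨A, hA⟩ := exists_cut hc
    exact cut5 hG ih hmd hmx hA
  have hlt := msr_del (G := G) (v := v) (by omega)
  have hW := W_del G v
  have d3 : dl 3 = 10 := rfl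
  have d4 : dl 4 = 5 := rfl
  have f5 : fw 5 = 19 := rfl
  rw [hv, f5] at hW
  by_cases h3 : ∃ w, G.Adj v w ∧ dg G w = 3
  · obtain ⟨w, hvw, hw⟩ := h3
    refine Good_del v ((ih _ hlt hc).a fun x => (Mx_del hmx v x).trans (by norm_num)) ?_
    have hs := sum_nb2 (c := 4) hvw (fun x hx => dl_ge4 (hmd.adj hx) (hmx x))
    rw [hv, hw, d3] at hs
    push_cast at hs
    linarith
  · push Not at h3
    have hu4 : dg G u = 4 := by
      have := hmx u
      have := hmd.adj hvu
      have := h3 u hvu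
      omega
    have e1 := dg_del_adj hvu
    refine Good_del v ((ih _ hlt hc).b (Mx_del hmx v) (Md_del hmd h3)
      (not_Reg u (by omega) (by omega)) (not_Reg u (by omega) (by omega))) ?_
    have hs := sum_nb2 (c := 4) hvu (fun x hx => dl_ge4 (hmd.adj hx) (hmx x))
    rw [hv, hu4, d4] at hs
    push_cast at hs
    linarith

theorem step_a5 {G : SimpleGraph V} (hG : Conn G) (ih : IH G) (hmd : Md G) (hmx : Mx G 5) :
    Good G 6 := by
  by_cases hr4 : Reg G 4
  · exact Good_le (by norm_num)
      (step_c hG ih hmd fun x => by rcases hr4 x with h | h <;> omega)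
  by_cases hr5 : Reg G 5
  swap
  · exact Good_le (by norm_num) (step_b hG ih hmd hmx hr5 hr4)
  by_cases h0 : ∀ x, dg G x = 0
  · exact Good_le (by norm_num) (Good_empty h0)
  push Not at h0
  obtain ⟨v, hv⟩ := h0
  have hv5 : dg G v = 5 := (hr5 v).resolve_left hv
  by_cases hc : Conn (del G v)
  swap
  · obtain ⟨A, hA⟩ := exists_cut hc
    exact Good_le (by norm_num) (cut5 hG ih hmd hmx hA)
  have h5 : ∀ x, G.Adj v x → dg G x = 5 := by
    intro x hx
    have := hmd.adj hx
    rcases hr5 x with h | h <;> omega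
  obtain ⟨w, hw⟩ := dg_pos.1 (show 0 < dg G v by omega)
  have e1 := dg_del_adj hw
  have e2 := h5 w hw
  have hm := ih _ (msr_del (G := G) (v := v) (by omega)) hc
  have hg : Good (del G v) 5 := by
    by_cases hr : Reg (del G v) 4
    · exact hm.c fun x => by rcases hr x with h | h <;> omega
    · exact Good_le (by norm_num) (hm.b (Mx_del hmx v)
        (Md_del hmd fun x hx => by rw [h5 x hx]; decide) (not_Reg w (by omega) (by omega)) hr)
  refine Good_del v hg ?_
  have hW := W_del G v
  have hs := sum_nb1 (G := G) (v := v) (c := 4) (fun x hx => dl_ge4 (hmd.adj hx) (hmx x))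
  rw [hv5] at hW hs
  have : fw 5 = 19 := rfl
  push_cast at hs
  linarith

theorem bridge6 {G : SimpleGraph V} (ih : IH G) (hmd : Md G) (hmx : Mx G 6)
    {v u : V} {H1 H2 : SimpleGraph V} (hb : Bridge G v u H1 H2) : Good G 6 := by
  refine hb.good 6 6 6 ((ih _ hb.m1 hb.c1).a (hb.mx1 hmx)) ((ih _ hb.m2 hb.c2).a (hb.mx2 hmx)) ?_
  linarith [dl_ge3 (hb.u3 hmd) (hmx u), dl_ge3 (hb.v3 hmd) (hmx v)]

theorem step_a {G : SimpleGraph V} (hG : Conn G) (ih : IH G) (hmd : Md G) (hmx : Mx G 6) :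
    Good G 6 := by
  by_cases h5 : Mx G 5
  · exact step_a5 hG ih hmd h5
  obtain ⟨z, hz⟩ : ∃ z, dg G z = 6 := by
    unfold Mx at h5
    push Not at h5
    obtain ⟨z, hz⟩ := h5
    exact ⟨z, by have := hmx z; omega⟩
  by_cases hnc : ∃ v, dg G v = 6 ∧ Conn (del G v)
  · obtain ⟨v, hv, hc⟩ := hnc
    refine Good_del v ((ih _ (msr_del (by omega)) hc).a (Mx_del hmx v)) ?_
    have hW := W_del G v
    have hs := sum_nb1 (G := G) (v := v) (c := 3) (fun x hx => dl_ge3 (hmd.adj hx) (hmx x))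
    rw [hv] at hW hs
    have : fw 6 = 22 := rfl
    push_cast at hs
    linarith
  push Not at hnc
  have hcut : ∀ v, dg G v = 6 → ∃ A, CutAt G v A := fun v hv => exists_cut (hnc v hv)
  classical
  have hex : ∃ n : ℕ, ∃ v A, dg G v = 6 ∧ CutAt G v A ∧ A.ncard = n := by
    obtain ⟨A, hA⟩ := hcut z hz
    exact ⟨_, z, A, hz, hA, rfl⟩
  obtain ⟨v, A, hv, hA, hAn⟩ := Nat.find_spec hex
  have hmin : ∀ w B, dg G w = 6 → CutAt G w B → A.ncard ≤ B.ncard := by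
    intro w B hw hB
    rw [hAn]
    exact Nat.find_min' hex ⟨w, B, hw, hB, rfl⟩
  have hA5 : ∀ w ∈ A, dg G w ≤ 5 := by
    intro w hw
    by_contra hcon
    have hw6 : dg G w = 6 := by have := hmx w; omega
    have hwv : w ≠ v := fun h => hA.1 (h ▸ hw)
    obtain ⟨B, hB, hvB⟩ : ∃ B, CutAt G w B ∧ v ∉ B := by
      obtain ⟨B, hB⟩ := hcut w hw6
      by_cases hvB : v ∈ B
      · exact ⟨_, CutAt_symm hB, fun h => h (Or.inr hvB)⟩
      · exact ⟨B, hB, hvB⟩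
    have hBA : CutAt G w (B ∩ A) := by
      refine ⟨fun h => hB.1 h.1, ?_, ?_, v, fun h => hvB h.1, hwv.symm, by omega⟩
      · rintro x y hxy ⟨hxB, hxA⟩
        rcases hB.2.1 x y hxy hxB with h | h
        · rcases hA.2.1 x y hxy hxA with h' | h'
          · exact Or.inl ⟨h, h'⟩
          · exact absurd (h' ▸ h) hvB
        · exact Or.inr h
      · by_contra hno
        push Not at hno
        obtain ⟨x, hxB, hxp⟩ := hB.2.2.1
        have hxA : x ∉ A := fun h => by
          have := hno x ⟨hxB, h⟩
          omega
        have := hG (B \ A) ?_ ⟨x, ⟨hxB, hxA⟩, hxp⟩ v (by omega)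
        · exact hvB this.1
        · rintro p q hpq ⟨hpB, hpA⟩
          have hqA : q ∉ A := by
            intro hqA
            rcases hA.2.1 q p hpq.symm hqA with h | h
            · exact hpA h
            · exact hvB (h ▸ hpB)
          rcases hB.2.1 p q hpq hpB with h | h
          · exact ⟨h, hqA⟩
          · exact absurd (h ▸ hw) hqA
    have hlt : (B ∩ A).ncard < A.ncard := by
      refine Set.ncard_lt_ncard ?_ (Set.toFinite A)
      refine ⟨Set.inter_subset_right, fun h => hB.1 (h hw).1⟩
    have := hmin w _ hw6 hBA
    omega
  have hs := cut_split hG hA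
  have hsi := fun x (hx : x ∈ A) => side_in hA hx
  have hso := fun x (hx : x ∉ A) (hxv : x ≠ v) => side_out (G := G) hx hxv
  generalize res G (insert v A) = G1 at hs hsi hso
  generalize res G (insert v (insert v A)ᶜ) = G2 at hs
  have p1 := hs.p1
  have p2 := hs.p2
  have hsum := hs.sum
  by_cases h1 : dg G1 v = 1
  · obtain ⟨u, hb⟩ := hs.bridge h1
    exact bridge6 ih hmd hmx hb
  by_cases h2 : dg G2 v = 1
  · obtain ⟨u, hb⟩ := hs.symm.bridge h2
    exact bridge6 ih hmd hmx hb
  have g1 := (ih _ hs.msr1 hs.c1).a (hs.mx1 hmx)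
  have g2 := (ih _ hs.symm.msr1 hs.c2).a (hs.symm.mx1 hmx)
  rcases (by omega : (dg G1 v = 2 ∧ dg G2 v = 4) ∨ (dg G1 v = 4 ∧ dg G2 v = 2) ∨
    (dg G1 v = 3 ∧ dg G2 v = 3)) with ⟨e1, e2⟩ | ⟨e1, e2⟩ | ⟨e1, e2⟩
  · refine hs.good 6 6 6 g1 g2 ?_
    rw [hv, e1, e2]; decide
  · refine hs.good 6 6 6 g1 g2 ?_
    rw [hv, e1, e2]; decide
  · have g1' : Good G1 2 := by
      refine (ih _ hs.msr1 hs.c1).b ?_ ?_ (not_Reg v (by omega) (by omega))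
        (not_Reg v (by omega) (by omega))
      · intro x
        by_cases hx : x = v
        · subst hx; omega
        by_cases hxA : x ∈ A
        · rw [hsi x hxA]; exact hA5 x hxA
        · rw [hso x hxA hx]; omega
      · intro x
        by_cases hx : x = v
        · subst hx; omega
        by_cases hxA : x ∈ A
        · rw [hsi x hxA]; exact hmd x
        · exact Or.inl (hso x hxA hx)
    refine hs.good 2 6 6 g1' g2 ?_
    rw [hv, e1, e2]; decide

theorem main_all (n : ℕ) : ∀ G : SimpleGraph V, msr G < n → Conn G → Main G := by
  induction n with
  | zero => intro G h; omega
  | succ n ihn =>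
    intro G hn hG
    have ih : IH G := fun H hH hc => ihn H (by omega) hc
    by_cases hlow : ∃ v, dg G v = 1 ∨ dg G v = 2
    · obtain ⟨v, hv⟩ := hlow
      exact step_low hG ih hv
    · have hmd : Md G := by
        intro x
        by_contra h
        exact hlow ⟨x, by omega⟩
      exact ⟨step_a hG ih hmd, fun h _ => step_b hG ih hmd h, step_c hG ih hmd,
        fun h _ => step_d hG ih hmd h, step_e hG ih hmd⟩

theorem Conn_of_connected {G : SimpleGraph V} (h : G.Connected) : Conn G := by
  rintro S hS ⟨x, hx, -⟩ z -
  by_contra hz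
  obtain ⟨p⟩ := h.preconnected x z
  obtain ⟨d, -, h1, h2⟩ := p.exists_boundary_dart S hx hz
  exact h2 (hS _ _ d.adj h1)

theorem ncard_eq_dg (G : SimpleGraph V) (x : V) : (G.neighborSet x).ncard = dg G x := by
  unfold dg
  rw [← Set.ncard_coe_finset]
  congr 1
  ext y
  rw [Finset.mem_coe, mem_nb, SimpleGraph.mem_neighborSet]

theorem W_eq (G : SimpleGraph V) (h : Mx G 6) :
    W G = 10 * ({v : V | (G.neighborSet v).ncard = 3}.ncard : ℤ)
      + 15 * ({v : V | (G.neighborSet v).ncard = 4}.ncard : ℤ)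
      + 19 * ({v : V | (G.neighborSet v).ncard = 5}.ncard : ℤ)
      + 22 * ({v : V | (G.neighborSet v).ncard = 6}.ncard : ℤ) := by
  classical
  have hc : ∀ k : ℕ, ({v : V | (G.neighborSet v).ncard = k}.ncard : ℤ) =
      ∑ x, if dg G x = k then 1 else 0 := by
    intro k
    rw [Finset.sum_boole, ← Set.ncard_coe_finset]
    congr 2
    ext y
    simp [ncard_eq_dg]
  rw [hc, hc, hc, hc, Finset.mul_sum, Finset.mul_sum, Finset.mul_sum, Finset.mul_sum,
    ← Finset.sum_add_distrib, ← Finset.sum_add_distrib, ← Finset.sum_add_distrib]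
  unfold W
  refine Finset.sum_congr rfl fun x _ => ?_
  have := h x
  generalize dg G x = d at *
  interval_cases d <;> rfl

end

end K4T

theorem statement4 {V : Type*} [Fintype V] (G : SimpleGraph V)
    (hconn : G.Connected)
    (hmaxdeg : ∀ v : V, (G.neighborSet v).ncard ≤ 6) :
    (transNum G : ℝ) ≤
        (1 / 4) * ({v : V | (G.neighborSet v).ncard = 3}.ncard : ℝ)
      + (3 / 8) * ({v : V | (G.neighborSet v).ncard = 4}.ncard : ℝ)
      + (19 / 40) * ({v : V | (G.neighborSet v).ncard = 5}.ncard : ℝ)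
      + (11 / 20) * ({v : V | (G.neighborSet v).ncard = 6}.ncard : ℝ)
      + 3 / 20 := by
  have hmx : K4T.Mx G 6 := fun x => by rw [← K4T.ncard_eq_dg]; exact hmaxdeg x
  obtain ⟨X, h1, h2⟩ := (K4T.main_all _ G (Nat.lt_succ_self _) (K4T.Conn_of_connected hconn)).a hmx
  have hle : transNum G ≤ X.card :=
    Nat.sInf_le ⟨X, rfl, fun h => h2 (K4T.K4M_of_minor G _ h)⟩
  rw [K4T.W_eq G hmx] at h1
  have h1' : (40 : ℝ) * (X.card : ℝ) ≤
      10 * ({v : V | (G.neighborSet v).ncard = 3}.ncard : ℝ)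
      + 15 * ({v : V | (G.neighborSet v).ncard = 4}.ncard : ℝ)
      + 19 * ({v : V | (G.neighborSet v).ncard = 5}.ncard : ℝ)
      + 22 * ({v : V | (G.neighborSet v).ncard = 6}.ncard : ℝ) + 6 := by
    exact_mod_cast h1
  have hle' : (transNum G : ℝ) ≤ X.card := by exact_mod_cast hle
  linarith
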